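/- Let G be a strongly connected digraph on n ≥ 2 vertices containing an m-wheel (a subgraph isomorphic to a directed cycle of length m plus a center vertex with an arc to every cycle vertex). Then G admits a boolean function f : {0,1}ⁿ → {0,1}ⁿ with interaction digraph G such that f^{2n−m+1} is constant. -/

import Mathlib

/-- `f i` depends essentially on coordinate `j` (boolean states). -/
def dependsB {n : ℕ} (f : (Fin n → Bool) → (Fin n → Bool)) (j i : Fin n) : Prop :=
  ∃ x y : Fin n → Bool, (∀ k, k ≠ j → x k = y k) ∧ f x i ≠ f y i

/-- A path `p 0, …, p r = v` leaving `C` only at `p 0`, together with a rank function such that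
every vertex outside `C` has an in-neighbour of smaller rank, and a vertex off the path of rank at
least that of `p s` has all its in-neighbours of rank at least that of `p s`. -/
structure RankedPath {V : Type*} (adj : V → V → Prop) (C : Finset V) (v : V) where
  r : ℕ
  p : ℕ → V
  rank : V → ℕ
  one_le_r : 1 ≤ r
  p_zero_mem : p 0 ∈ C
  p_last : p r = v
  p_adj : ∀ s < r, adj (p s) (p (s + 1))
  rank_p_lt : ∀ s < r, rank (p s) < rank (p (s + 1))
  rank_eq_zero : ∀ x ∈ C, rank x = 0
  exists_parent : ∀ x ∉ C, ∃ y, adj y x ∧ rank y < rank x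
  separated : ∀ q ∉ C, (∀ s, 1 ≤ s → s ≤ r → q ≠ p s) → ∀ s, 1 ≤ s → s ≤ r →
    rank (p s) ≤ rank q → ∀ j, adj j q → rank (p s) ≤ rank j

/-- A distance-like function from a nonempty set of vertices. -/
theorem exists_dist {V : Type*} (adj : V → V → Prop)
    (hstrong : ∀ u v, Relation.ReflTransGen adj u v) (C : Finset V) (hC : C.Nonempty) :
    ∃ d : V → ℕ, (∀ x, d x = 0 ↔ x ∈ C) ∧ ∀ x k, d x = k + 1 → ∃ y, adj y x ∧ d y = k := by
  classical
  let W : ℕ → V → Prop := fun k => Nat.rec (motive := fun _ => V → Prop)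
    (fun x => x ∈ C) (fun _ ih x => ∃ y, ih y ∧ adj y x) k
  have hW : ∀ x, ∃ k, W k x := by
    intro x
    obtain ⟨c, hc⟩ := hC
    induction hstrong c x with
    | refl => exact ⟨0, hc⟩
    | tail _ h ih => exact ⟨ih.choose + 1, _, ih.choose_spec, h⟩
  refine ⟨fun x => Nat.find (hW x), fun x => Nat.find_eq_zero (hW x), fun x k hk => ?_⟩
  have hx := Nat.find_spec (hW x)
  change Nat.find (hW x) = k + 1 at hk
  rw [hk] at hx
  obtain ⟨y, hy, hyx⟩ := hx
  refine ⟨y, hyx, le_antisymm (Nat.find_min' _ hy) ?_⟩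
  have : Nat.find (hW x) ≤ Nat.find (hW y) + 1 :=
    Nat.find_min' _ ⟨y, Nat.find_spec (hW y), hyx⟩
  exact Nat.le_of_succ_le_succ (hk.symm.le.trans this)

theorem exists_path_of_dist {V : Type*} (adj : V → V → Prop) (d : V → ℕ)
    (hd : ∀ x k, d x = k + 1 → ∃ y, adj y x ∧ d y = k) :
    ∀ (r : ℕ) (v : V), d v = r →
      ∃ p : ℕ → V, p r = v ∧ (∀ s ≤ r, d (p s) = s) ∧ ∀ s < r, adj (p s) (p (s + 1)) := by
  intro r
  induction r with
  | zero =>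
    intro v hv
    exact ⟨fun _ => v, rfl, fun s hs => by simp [hv]; omega, fun s hs => by omega⟩
  | succ r ih =>
    intro v hv
    obtain ⟨y, hyv, hy⟩ := hd v r hv
    obtain ⟨p, hp, hpd, hpa⟩ := ih y hy
    refine ⟨fun s => if s ≤ r then p s else v, by simp, fun s hs => ?_, fun s hs => ?_⟩
    · by_cases h : s ≤ r
      · simpa [h] using hpd s h
      · simp only [h, if_false]; omega
    · rcases Nat.lt_succ_iff_lt_or_eq.mp hs with h | h
      · simpa [h.le, Nat.succ_le_of_lt h] using hpa s h
      · subst h; simpa [hp] using hyv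

/-- Add to `L` the out-neighbours of `L` off the path; if there are none, add the next vertex of
the path. -/
def growSet {V : Type*} (adj : V → V → Prop) (p : ℕ → V) (r : ℕ) (L : Set V) : Set V :=
  L ∪ {q | ((∀ s, 1 ≤ s → s ≤ r → q ≠ p s) ∧ ∃ j ∈ L, adj j q) ∨
    ((∀ q', (∀ s, 1 ≤ s → s ≤ r → q' ≠ p s) → (∃ j ∈ L, adj j q') → q' ∈ L) ∧
      ∃ s < r, p s ∈ L ∧ q = p (s + 1))}

theorem eq_univ_of_growSet_eq {V : Type*} (adj : V → V → Prop)
    (hstrong : ∀ u v, Relation.ReflTransGen adj u v) (p : ℕ → V) (r : ℕ) (L : Set V)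
    (h0 : p 0 ∈ L) (hL : growSet adj p r L = L) (x : V) : x ∈ L := by
  have hq : ∀ q', (∀ s, 1 ≤ s → s ≤ r → q' ≠ p s) → (∃ j ∈ L, adj j q') → q' ∈ L := by
    intro q' h1 h2
    rw [← hL]
    exact Or.inr (Or.inl ⟨h1, h2⟩)
  have hp : ∀ s ≤ r, p s ∈ L := by
    intro s
    induction s with
    | zero => exact fun _ => h0
    | succ s ih =>
      intro hs
      rw [← hL]
      exact Or.inr (Or.inr ⟨hq, s, hs, ih (by omega), rfl⟩)
  induction hstrong (p 0) x with
  | refl => exact h0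
  | @tail b c _ h ih =>
    by_cases hc : ∀ s, 1 ≤ s → s ≤ r → c ≠ p s
    · exact hq c hc ⟨b, ih, h⟩
    · push Not at hc
      obtain ⟨s, _, hs, rfl⟩ := hc
      exact hp s hs

theorem exists_rankedPath {V : Type*} [Finite V] (adj : V → V → Prop)
    (hstrong : ∀ u v, Relation.ReflTransGen adj u v) (C : Finset V) (hC : C.Nonempty) (v : V)
    (hv : v ∉ C) : Nonempty (RankedPath adj C v) := by
  classical
  obtain ⟨d, hd0, hd⟩ := exists_dist adj hstrong C hC
  obtain ⟨p, hpr, hpd, hpa⟩ := exists_path_of_dist adj d hd (d v) v rfl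
  set r := d v
  have hr : 1 ≤ r := Nat.one_le_iff_ne_zero.mpr fun h => hv ((hd0 v).mp h)
  have hpC : p 0 ∈ C := (hd0 _).mp (hpd 0 (by omega))
  have hpnC : ∀ s, 1 ≤ s → s ≤ r → p s ∉ C := fun s h1 h2 h => by
    have := (hd0 _).mpr h
    rw [hpd s h2] at this
    omega
  let L : ℕ → Set V := fun k => (growSet adj p r)^[k] (C : Set V)
  have hLs : ∀ k, L (k + 1) = growSet adj p r (L k) := fun k =>
    Function.iterate_succ_apply' _ _ _
  have hmono : Monotone L := monotone_nat_of_le_succ fun k => by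
    rw [hLs]; exact Set.subset_union_left
  have hex : ∀ x, ∃ k, x ∈ L k := by
    intro x
    obtain ⟨N, hN⟩ := WellFoundedGT.monotone_chain_condition ⟨L, hmono⟩
    have hN1 : L N = L (N + 1) := hN (N + 1) (by omega)
    refine ⟨N, eq_univ_of_growSet_eq adj hstrong p r (L N) (hmono (Nat.zero_le N) hpC) ?_ x⟩
    rw [← hLs, ← hN1]
  let rank : V → ℕ := fun x => Nat.find (hex x)
  have hle : ∀ x k, rank x ≤ k ↔ x ∈ L k := fun x k =>
    ⟨fun h => hmono h (Nat.find_spec (hex x)), fun h => Nat.find_min' _ h⟩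
  have hsucc : ∀ x ∉ C, ∃ k, rank x = k + 1 ∧ x ∉ L k ∧ x ∈ growSet adj p r (L k) := by
    intro x hx
    have h0 : rank x ≠ 0 := fun h => hx ((hle x 0).mp h.le)
    obtain ⟨k, hk⟩ := Nat.exists_eq_succ_of_ne_zero h0
    refine ⟨k, hk, fun h => ?_, ?_⟩
    · have := (hle x k).mpr h; omega
    · rw [← hLs]; exact (hle x _).mp hk.le
  have hpk : ∀ s < r, ∃ k, rank (p (s + 1)) = k + 1 ∧ p s ∈ L k ∧
      (∀ q', (∀ s, 1 ≤ s → s ≤ r → q' ≠ p s) → (∃ j ∈ L k, adj j q') → q' ∈ L k) := by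
    intro s hs
    obtain ⟨k, hk, hnk, hmem⟩ := hsucc _ (hpnC (s + 1) (by omega) hs)
    refine ⟨k, hk, ?_⟩
    rcases hmem with h | ⟨h, _⟩ | ⟨h, s', hs', hp', he⟩
    · exact absurd h hnk
    · exact absurd rfl (h (s + 1) (by omega) hs)
    · have := congrArg d he
      rw [hpd _ hs, hpd _ hs'] at this
      obtain rfl : s = s' := by omega
      exact ⟨hp', h⟩
  refine ⟨{ r := r, p := p, rank := rank, one_le_r := hr, p_zero_mem := hpC, p_last := hpr
            p_adj := hpa, rank_p_lt := ?_, rank_eq_zero := ?_, exists_parent := ?_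
            separated := ?_ }⟩
  · intro s hs
    obtain ⟨k, hk, hm, _⟩ := hpk s hs
    have := (hle _ _).mpr hm
    omega
  · exact fun x hx => Nat.le_zero.mp ((hle x 0).mpr hx)
  · intro x hx
    obtain ⟨k, hk, hnk, hmem⟩ := hsucc x hx
    rcases hmem with h | ⟨_, j, hj, ha⟩ | ⟨_, s, hs, hp', rfl⟩
    · exact absurd h hnk
    · exact ⟨j, ha, by have := (hle j k).mpr hj; omega⟩
    · exact ⟨p s, hpa s hs, by have := (hle _ k).mpr hp'; omega⟩
  · intro q _ hq s h1 h2 hsq j hj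
    obtain ⟨s, rfl⟩ := Nat.exists_eq_succ_of_ne_zero (Nat.one_le_iff_ne_zero.mp h1)
    obtain ⟨k, hk, _, hcl⟩ := hpk s h2
    by_contra hlt
    simp only [Nat.succ_eq_add_one] at hsq hlt
    have := (hle q k).mpr (hcl q hq ⟨j, (hle j k).mp (by omega), hj⟩)
    omega

namespace RankedPath

variable {V : Type*} {adj : V → V → Prop} {C : Finset V} {v : V} (R : RankedPath adj C v)

/-- The vertices of the path outside `C`. -/
def OnPath (x : V) : Prop := ∃ s, 1 ≤ s ∧ s ≤ R.r ∧ x = R.p s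

open Classical in
/-- Vertices of the path fire when some lower-ranked in-neighbour is on and all other in-neighbours
are off; the remaining vertices are conjunctions, with negative literals from `v` to `C`. -/
noncomputable def network (x : V → Bool) (i : V) : Bool :=
  decide (if R.OnPath i then
    (∃ j, adj j i ∧ R.rank j < R.rank i ∧ x j = true) ∧
      ∀ j, adj j i → R.rank i ≤ R.rank j → x j = false
  else ∀ j, adj j i → x j = !decide (j = v ∧ i ∈ C))

theorem rank_p_strictMono {s t : ℕ} (hst : s < t) (ht : t ≤ R.r) :
    R.rank (R.p s) < R.rank (R.p t) := by
  induction t with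
  | zero => omega
  | succ t ih =>
    have h := R.rank_p_lt t ht
    rcases Nat.lt_succ_iff_lt_or_eq.mp hst with h' | rfl
    · exact (ih h' (by omega)).trans h
    · exact h

theorem rank_p_pos {s : ℕ} (h1 : 1 ≤ s) (h2 : s ≤ R.r) : 0 < R.rank (R.p s) :=
  (Nat.zero_le _).trans_lt (R.rank_p_strictMono (s := 0) h1 h2)

theorem le_of_rank_p_le {s t : ℕ} (hs : s ≤ R.r) (h : R.rank (R.p s) ≤ R.rank (R.p t)) :
    s ≤ t := by
  by_contra hlt
  have := R.rank_p_strictMono (not_le.mp hlt) hs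
  omega

theorem notMem_of_rank_pos {x : V} (h : 0 < R.rank x) : x ∉ C := fun hx => by
  have := R.rank_eq_zero x hx
  omega

theorem not_onPath_of_mem {x : V} (hx : x ∈ C) : ¬ R.OnPath x := by
  rintro ⟨s, h1, h2, rfl⟩
  exact R.notMem_of_rank_pos (R.rank_p_pos h1 h2) hx

theorem network_onPath {x : V → Bool} {i : V} (hi : R.OnPath i) :
    R.network x i = true ↔ (∃ j, adj j i ∧ R.rank j < R.rank i ∧ x j = true) ∧
      ∀ j, adj j i → R.rank i ≤ R.rank j → x j = false := by
  simp only [network, if_pos hi, decide_eq_true_eq]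

open Classical in
theorem network_not_onPath {x : V → Bool} {i : V} (hi : ¬ R.OnPath i) :
    R.network x i = true ↔ ∀ j, adj j i → x j = !decide (j = v ∧ i ∈ C) := by
  simp only [network, if_neg hi, decide_eq_true_eq]

theorem network_eq_false_of_parent {x : V → Bool} {i j : V} (hi : ¬ R.OnPath i) (hji : adj j i)
    (hv : j = v → i ∉ C) (hj : x j = false) : R.network x i = false := by
  classical
  by_contra h
  rw [Bool.not_eq_false, R.network_not_onPath hi] at h
  have h' := h j hji
  have : ¬ (j = v ∧ i ∈ C) := fun h => hv h.1 h.2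
  simp [this, hj] at h'

theorem network_congr {x y : V → Bool} {i : V} (h : ∀ j, adj j i → x j = y j) :
    R.network x i = R.network y i := by
  classical
  rw [Bool.eq_iff_iff]
  by_cases hi : R.OnPath i
  · rw [R.network_onPath hi, R.network_onPath hi]
    refine and_congr (exists_congr fun j => and_congr_right fun hj => ?_)
      (forall_congr' fun j => imp_congr_right fun hj => ?_) <;> rw [h j hj]
  · rw [R.network_not_onPath hi, R.network_not_onPath hi]
    exact forall_congr' fun j => imp_congr_right fun hj => by rw [h j hj]

theorem exists_network_ne {i j : V} (hji : adj j i) :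
    ∃ x y : V → Bool, (∀ k, k ≠ j → x k = y k) ∧ R.network x i ≠ R.network y i := by
  classical
  by_cases hi : R.OnPath i
  · by_cases hlt : R.rank j < R.rank i
    · refine ⟨fun k => decide (k = j), fun _ => false, fun k hk => by simp [hk], ?_⟩
      have h1 : R.network (fun k => decide (k = j)) i = true := by
        rw [R.network_onPath hi]
        refine ⟨⟨j, hji, hlt, by simp⟩, fun k _ hk => ?_⟩
        have : k ≠ j := by rintro rfl; omega
        simp [this]
      have h2 : ¬ R.network (fun _ => false) i = true := by
        rw [R.network_onPath hi]
        simp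
      exact fun h => h2 (h ▸ h1)
    · refine ⟨fun k => decide (R.rank k < R.rank i),
        fun k => decide (R.rank k < R.rank i ∨ k = j), fun k hk => by simp [hk], ?_⟩
      have hiC : i ∉ C := fun h => R.not_onPath_of_mem h hi
      have h1 : R.network (fun k => decide (R.rank k < R.rank i)) i = true := by
        rw [R.network_onPath hi]
        obtain ⟨y, hy, hyi⟩ := R.exists_parent i hiC
        exact ⟨⟨y, hy, hyi, by simpa using hyi⟩, fun k _ hk => by simpa using hk⟩
      have h2 : ¬ R.network (fun k => decide (R.rank k < R.rank i ∨ k = j)) i = true := by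
        rw [R.network_onPath hi]
        rintro ⟨_, h⟩
        simpa using h j hji (not_lt.mp hlt)
      exact fun h => h2 (h ▸ h1)
  · let x : V → Bool := fun k => !decide (k = v ∧ i ∈ C)
    refine ⟨x, Function.update x j (!(x j)), fun k hk => by simp [hk], ?_⟩
    have h1 : R.network x i = true := (R.network_not_onPath hi).mpr fun k _ => rfl
    have h2 : ¬ R.network (Function.update x j (!(x j))) i = true := by
      rw [R.network_not_onPath hi]
      intro h
      have h' : Function.update x j (!(x j)) j = x j := h j hji
      simp at h'
    exact fun h => h2 (h ▸ h1)

/-- The index of the last vertex of the path whose rank is at most that of `x`. -/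
noncomputable def stage (x : V) : ℕ := Nat.findGreatest (fun s => R.rank (R.p s) ≤ R.rank x) R.r

theorem stage_le (x : V) : R.stage x ≤ R.r := Nat.findGreatest_le _

theorem rank_p_stage_le (x : V) : R.rank (R.p (R.stage x)) ≤ R.rank x :=
  Nat.findGreatest_spec (P := fun s => R.rank (R.p s) ≤ R.rank x) (Nat.zero_le R.r)
    (by simp [R.rank_eq_zero _ R.p_zero_mem])

theorem le_stage {s : ℕ} {x : V} (hs : s ≤ R.r) (h : R.rank (R.p s) ≤ R.rank x) :
    s ≤ R.stage x :=
  Nat.le_findGreatest (P := fun s => R.rank (R.p s) ≤ R.rank x) hs h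

theorem stage_mono {x y : V} (h : R.rank x ≤ R.rank y) : R.stage x ≤ R.stage y :=
  R.le_stage (R.stage_le x) ((R.rank_p_stage_le x).trans h)

/-- The vertices off the path and outside `C` ranked above the first path vertex outside `C`. -/
def Late (q : V) : Prop := q ∉ C ∧ ¬ R.OnPath q ∧ 1 ≤ R.stage q

theorem Late.rank_p_stage_le_rank {R : RankedPath adj C v} {q j : V} (hq : R.Late q)
    (hj : adj j q) : R.rank (R.p (R.stage q)) ≤ R.rank j :=
  R.separated q hq.1 (fun s h1 h2 h => hq.2.1 ⟨s, h1, h2, h⟩) _ hq.2.2 (R.stage_le q)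
    (R.rank_p_stage_le q) j hj

theorem onPath_or_late {s : ℕ} {x : V} (h1 : 1 ≤ s) (h2 : s ≤ R.r)
    (h : R.rank (R.p s) ≤ R.rank x) :
    (∃ t, s ≤ t ∧ t ≤ R.r ∧ x = R.p t) ∨ (R.Late x ∧ s ≤ R.stage x) := by
  by_cases hx : R.OnPath x
  · obtain ⟨t, _, ht, rfl⟩ := hx
    exact Or.inl ⟨t, R.le_of_rank_p_le h2 h, ht, rfl⟩
  · have hs := R.le_stage h2 h
    exact Or.inr ⟨⟨R.notMem_of_rank_pos ((R.rank_p_pos h1 h2).trans_le h), hx, h1.trans hs⟩, hs⟩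

/-- The wavefront has reached `p s`: it is on, and nothing off the path is on at a later stage. -/
def Front (x : V → Bool) (s : ℕ) : Prop :=
  1 ≤ s ∧ s ≤ R.r ∧ x (R.p s) = true ∧ ∀ q, R.Late q → s < R.stage q → x q = false

theorem eq_false_of_rank {x : V → Bool} {s : ℕ} (hs : s + 1 ≤ R.r)
    (hlate : ∀ q, R.Late q → s < R.stage q → x q = false)
    (hp : ∀ t, s < t → t ≤ R.r → x (R.p t) = false) {j : V}
    (hj : R.rank (R.p (s + 1)) ≤ R.rank j) : x j = false := by
  rcases R.onPath_or_late (Nat.le_add_left 1 s) hs hj with ⟨t, h1, h2, rfl⟩ | ⟨h1, h2⟩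
  · exact hp t h1 h2
  · exact hlate j h1 h2

theorem Front.step {R : RankedPath adj C v} {x : V → Bool} {s : ℕ} (h : R.Front x s)
    (hs : s + 1 ≤ R.r) (hp : ∀ t, s < t → t ≤ R.r → x (R.p t) = false) :
    R.Front (R.network x) (s + 1) := by
  obtain ⟨h1, h2, h3, h4⟩ := h
  refine ⟨Nat.le_add_left 1 s, hs, ?_, fun q hq hlt => ?_⟩
  · rw [R.network_onPath ⟨s + 1, Nat.le_add_left 1 s, hs, rfl⟩]
    exact ⟨⟨R.p s, R.p_adj s hs, R.rank_p_lt s hs, h3⟩,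
      fun j _ hj => R.eq_false_of_rank hs h4 hp hj⟩
  · obtain ⟨y, hy, _⟩ := R.exists_parent q hq.1
    refine R.network_eq_false_of_parent hq.2.1 hy (fun _ => hq.1)
      (R.eq_false_of_rank hs h4 hp ?_)
    exact (R.rank_p_strictMono hlt (R.stage_le q)).le.trans (hq.rank_p_stage_le_rank hy)

theorem Front.exists_last {R : RankedPath adj C v} {x : V → Bool} {s : ℕ} (h : R.Front x s) :
    ∃ k ≤ R.r - s, R.network^[k] x v = true := by
  obtain ⟨d, hd⟩ : ∃ d, R.r - s = d := ⟨_, rfl⟩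
  induction d using Nat.strong_induction_on generalizing x s with
  | _ d ih =>
    by_cases hp : ∀ t, s < t → t ≤ R.r → x (R.p t) = false
    · rcases h.2.1.lt_or_eq with hs | hs
      · obtain ⟨k, hk, hv⟩ := ih (R.r - (s + 1)) (by omega) (h.step hs hp) rfl
        exact ⟨k + 1, by omega, hv⟩
      · refine ⟨0, Nat.zero_le _, ?_⟩
        have := h.2.2.1
        rwa [hs, R.p_last] at this
    · push Not at hp
      obtain ⟨t, hst, ht, hxt⟩ := hp
      have hF : R.Front x t := ⟨by omega, ht, by simpa using hxt,
        fun q hq hlt => h.2.2.2 q hq (hst.trans hlt)⟩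
      obtain ⟨k, hk, hv⟩ := ih (R.r - t) (by omega) hF rfl
      exact ⟨k, by omega, hv⟩

variable [Fintype V]

open Classical in
/-- The late vertices, in the order in which they are switched off in the absence of a front:
by decreasing stage and, within a stage, by increasing rank. -/
noncomputable def lateUpTo (q : V) : Finset V :=
  {x | R.Late x ∧ (R.stage q < R.stage x ∨ R.stage x = R.stage q ∧ R.rank x ≤ R.rank q)}

theorem mem_lateUpTo {q x : V} : x ∈ R.lateUpTo q ↔
    R.Late x ∧ (R.stage q < R.stage x ∨ R.stage x = R.stage q ∧ R.rank x ≤ R.rank q) := by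
  simp [lateUpTo]

theorem card_lateUpTo_lt {q x : V} (hq : R.Late q)
    (h : R.stage q < R.stage x ∨ R.stage x = R.stage q ∧ R.rank x < R.rank q) :
    (R.lateUpTo x).card < (R.lateUpTo q).card := by
  refine Finset.card_lt_card (Finset.ssubset_iff_of_subset (fun y hy => ?_) |>.mpr
    ⟨q, R.mem_lateUpTo.mpr ⟨hq, Or.inr ⟨rfl, le_rfl⟩⟩, fun hy => ?_⟩)
  · rw [mem_lateUpTo] at hy ⊢
    exact ⟨hy.1, by omega⟩
  · rw [mem_lateUpTo] at hy
    omega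

theorem late_eq_false_of_no_front {X : ℕ → V → Bool} (hX : ∀ t, X (t + 1) = R.network (X t))
    (t : ℕ) : (∀ t' < t, ∀ s, ¬ R.Front (X t') s) →
      ∀ q, R.Late q → (R.lateUpTo q).card ≤ t → X t q = false := by
  induction t with
  | zero =>
    intro _ q hq hc
    have : q ∈ R.lateUpTo q := R.mem_lateUpTo.mpr ⟨hq, Or.inr ⟨rfl, le_rfl⟩⟩
    have := Finset.card_pos.mpr ⟨q, this⟩
    omega
  | succ t ih =>
    intro hno q hq hc
    have ih' := ih fun t' ht' => hno t' (by omega)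
    obtain ⟨j, hjq, hj⟩ := R.exists_parent q hq.1
    rw [hX]
    refine R.network_eq_false_of_parent hq.2.1 hjq (fun _ => hq.1) ?_
    have hst := R.stage_mono hj.le
    rcases R.onPath_or_late hq.2.2 (R.stage_le q) (hq.rank_p_stage_le_rank hjq) with
      ⟨s, h1, h2, rfl⟩ | ⟨h1, h2⟩
    · have := R.le_stage h2 le_rfl
      by_contra hne
      refine hno t (by omega) s ⟨hq.2.2.trans h1, h2, by simpa using hne, fun x hx hlt => ?_⟩
      have := R.card_lateUpTo_lt (x := x) hq (Or.inl (by omega))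
      exact ih' x hx (by omega)
    · have := R.card_lateUpTo_lt (x := j) hq (Or.inr ⟨by omega, hj⟩)
      exact ih' j h1 (by omega)

open Classical in
theorem exists_card_le :
    ∃ K, K + C.card + R.r ≤ Fintype.card V ∧ ∀ q, R.Late q → (R.lateUpTo q).card ≤ K := by
  refine ⟨(Finset.univ.filter R.Late).card, ?_, fun q _ => Finset.card_le_card fun x hx => ?_⟩
  · have hP : ((Finset.Icc 1 R.r).image R.p).card = R.r := by
      rw [Finset.card_image_of_injOn, Nat.card_Icc, Nat.add_sub_cancel]
      intro s hs t ht hst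
      simp only [Finset.coe_Icc, Set.mem_Icc] at hs ht
      exact le_antisymm (R.le_of_rank_p_le hs.2 (by rw [hst]))
        (R.le_of_rank_p_le ht.2 (by rw [hst]))
    rw [← hP, ← Finset.card_union_of_disjoint, ← Finset.card_union_of_disjoint]
    · exact Finset.card_le_univ _
    · rw [Finset.disjoint_right]
      intro x hx
      obtain ⟨s, hs, rfl⟩ := Finset.mem_image.mp hx
      rw [Finset.mem_Icc] at hs
      have hx : R.OnPath (R.p s) := ⟨s, hs.1, hs.2, rfl⟩
      simp only [Finset.mem_union, Finset.mem_filter, not_or]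
      exact ⟨fun h => h.2.2.1 hx, fun h => R.not_onPath_of_mem h hx⟩
    · rw [Finset.disjoint_right]
      exact fun x hx h => (Finset.mem_filter.mp h).2.1 hx
  · simpa using (R.mem_lateUpTo.mp hx).1

/-- Within `card V` steps `C` is off: as long as it is partly on, each of its vertices is on once
every `card C` steps, so a front starts, reaches `v`, and `v` switches `C` off. -/
theorem exists_forall_mem_eq_false {X : ℕ → V → Bool}
    (hX : ∀ t, X (t + 1) = R.network (X t)) (hv : ∀ c ∈ C, adj v c)
    (hrot : ∀ c ∈ C, ∀ t, (∀ k < C.card, X (t + k) c = false) →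
      ∀ c' ∈ C, X (t + (C.card - 1)) c' = false) :
    ∃ t ≤ Fintype.card V, ∀ c ∈ C, X t c = false := by
  classical
  by_contra! hne
  obtain ⟨K, hK, hlate⟩ := R.exists_card_le
  have hr := R.one_le_r
  have hCpos : 0 < C.card := Finset.card_pos.mpr ⟨_, R.p_zero_mem⟩
  have hXk : ∀ k t, R.network^[k] (X t) = X (t + k) := by
    intro k
    induction k with
    | zero => exact fun t => rfl
    | succ k ih =>
      intro t
      rw [Function.iterate_succ_apply, ← hX, ih]
      congr 1
      omega
  have hvoff : ∀ t < Fintype.card V, X t v = false := by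
    intro t ht
    by_contra h
    obtain ⟨c, hc, hcon⟩ := hne (t + 1) ht
    refine hcon ?_
    by_contra hcon
    rw [Bool.not_eq_false, hX, R.network_not_onPath (R.not_onPath_of_mem hc)] at hcon
    have := hcon v (hv c hc)
    simp [hc, h] at this
  have hno : ∀ t ≤ K + C.card, ∀ s, ¬ R.Front (X t) s := by
    intro t ht s hF
    obtain ⟨k, hk, hon⟩ := hF.exists_last
    have h1 := hF.1
    rw [hXk, hvoff _ (by omega)] at hon
    exact absurd hon (by simp)
  have hq : ∀ t, K ≤ t → t ≤ K + C.card → ∀ q, R.Late q → X t q = false := fun t h1 h2 q hq =>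
    R.late_eq_false_of_no_front hX t (fun t' _ => hno t' (by omega)) q hq ((hlate q hq).trans h1)
  have hp : ∀ t, K ≤ t → t ≤ K + C.card → ∀ s, 1 ≤ s → s ≤ R.r → X t (R.p s) = false := by
    intro t h1 h2 s hs1 hs2
    by_contra h
    exact hno t h2 s ⟨hs1, hs2, by simpa using h, fun q hq' _ => hq t h1 h2 q hq'⟩
  obtain ⟨c', hc', hon⟩ := hne (K + (C.card - 1)) (by omega)
  refine hon (hrot (R.p 0) R.p_zero_mem K (fun k hk => ?_) c' hc')
  by_contra h
  have hoff := hp (K + k + 1) (by omega) (by omega) 1 le_rfl hr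
  rw [hX, ← Bool.not_eq_true, R.network_onPath ⟨1, le_rfl, hr, rfl⟩] at hoff
  refine hoff ⟨⟨R.p 0, R.p_adj 0 hr, R.rank_p_lt 0 hr, by simpa using h⟩, fun j _ hj => ?_⟩
  rcases R.onPath_or_late le_rfl hr hj with ⟨s, h1, h2, rfl⟩ | ⟨h1, _⟩
  · exact hp _ (by omega) (by omega) s h1 h2
  · exact hq _ (by omega) (by omega) j h1

/-- Once `C` is off it stays off, and the other vertices are switched off by increasing rank. -/
theorem eq_false_of_forall_mem_eq_false {X : ℕ → V → Bool}
    (hX : ∀ t, X (t + 1) = R.network (X t)) (hvC : v ∉ C) (hpred : ∀ c ∈ C, ∃ c' ∈ C, adj c' c)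
    {t : ℕ} (h : ∀ c ∈ C, X t c = false) (k : ℕ) (hk : Fintype.card V ≤ k + C.card) (i : V) :
    X (t + k) i = false := by
  classical
  let D : V → ℕ := fun i => (Finset.univ.filter fun x => x ∉ C ∧ R.rank x ≤ R.rank i).card
  have hDlt : ∀ i j, i ∉ C → R.rank j < R.rank i → D j < D i := fun i j hi hlt => by
    refine Finset.card_lt_card (Finset.ssubset_iff_of_subset (fun y hy => ?_) |>.mpr
      ⟨i, by simp [hi], by simp [hi, hlt]⟩)
    simp only [Finset.mem_filter, Finset.mem_univ, true_and] at hy ⊢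
    exact ⟨hy.1, hy.2.trans hlt.le⟩
  have hD : D i ≤ k := by
    have : D i ≤ Cᶜ.card := Finset.card_le_card fun x hx => by
      simp only [Finset.mem_filter] at hx
      simpa using hx.2.1
    rw [Finset.card_compl] at this
    omega
  suffices H : ∀ k i, (i ∈ C ∨ D i ≤ k) → X (t + k) i = false from H k i (Or.inr hD)
  intro k
  induction k with
  | zero =>
    rintro i (hi | hi)
    · exact h i hi
    · by_cases hi' : i ∈ C
      · exact h i hi'
      · have : 0 < D i := Finset.card_pos.mpr ⟨i, by simp [hi']⟩
        omega
  | succ k ih =>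
    intro i hi
    rw [← Nat.add_assoc, hX]
    by_cases hi' : i ∈ C
    · obtain ⟨c', hc', ha⟩ := hpred i hi'
      exact R.network_eq_false_of_parent (R.not_onPath_of_mem hi') ha
        (fun h => absurd (h ▸ hc') hvC) (ih c' (Or.inl hc'))
    · have hlow : ∀ j, R.rank j < R.rank i → X (t + k) j = false := fun j hj => by
        have := hDlt i j hi' hj
        have := hi.resolve_left hi'
        exact ih j (Or.inr (by omega))
      by_cases hP : R.OnPath i
      · rw [← Bool.not_eq_true, R.network_onPath hP]
        rintro ⟨⟨j, _, hj, hon⟩, _⟩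
        simp [hlow j hj] at hon
      · obtain ⟨j, hji, hj⟩ := R.exists_parent i hi'
        exact R.network_eq_false_of_parent hP hji (fun _ => hi') (hlow j hj)

end RankedPath

/-- a strongly connected digraph on `n ≥ 2` vertices containing an `m`-wheel
(a directed cycle on `m` vertices plus a center with an arc to each cycle vertex) admits a
boolean function whose `(2n−m+1)`-st iterate is constant. -/
theorem stmt13 (n m : ℕ) (adj : Fin n → Fin n → Prop) (hn : 2 ≤ n) (hm : 0 < m)
    (hstrong : ∀ u v, Relation.ReflTransGen adj u v)
    (hwheel : ∃ (v : Fin n) (c : Fin m → Fin n), Function.Injective c ∧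
      (∀ k, v ≠ c k) ∧
      (∀ k : Fin m, adj (c k) (c ⟨((k : ℕ) + 1) % m, Nat.mod_lt _ hm⟩)) ∧
      (∀ k, adj v (c k))) :
    ∃ f : (Fin n → Bool) → (Fin n → Bool),
      (∀ j i, dependsB f j i ↔ adj j i) ∧
      ∃ c, f^[2 * n - m + 1] = Function.const _ c := by
  classical
  obtain ⟨v, c, hinj, hvc, hcyc, hvadj⟩ := hwheel
  set C : Finset (Fin n) := Finset.univ.image c with hC
  have hmemC : ∀ k, c k ∈ C := fun k => Finset.mem_image_of_mem c (Finset.mem_univ k)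
  have hCex : ∀ x ∈ C, ∃ k, c k = x := fun x hx => by simpa [hC] using hx
  have hcard : C.card = m := by rw [hC, Finset.card_image_of_injective _ hinj]; simp
  have hvC : v ∉ C := fun h => by obtain ⟨k, hk⟩ := hCex v h; exact hvc k hk.symm
  obtain ⟨R⟩ := exists_rankedPath adj hstrong C ⟨_, hmemC ⟨0, hm⟩⟩ v hvC
  refine ⟨R.network, fun j i => ⟨?_, R.exists_network_ne⟩, fun _ => false, ?_⟩
  · rintro ⟨x, y, hxy, hne⟩
    by_contra h
    exact hne (R.network_congr fun k hk => hxy k (by rintro rfl; exact h hk))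
  have hpred : ∀ x ∈ C, ∃ y ∈ C, adj y x := by
    intro x hx
    obtain ⟨k, rfl⟩ := hCex x hx
    refine ⟨c ⟨(k + (m - 1)) % m, Nat.mod_lt _ hm⟩, hmemC _, ?_⟩
    convert hcyc _ using 2
    have hk := k.2
    have he : (k : ℕ) + (m - 1) + 1 = k + m := by omega
    simp [he, Nat.mod_eq_of_lt hk]
  funext x
  let X : ℕ → Fin n → Bool := fun t => R.network^[t] x
  have hX : ∀ t, X (t + 1) = R.network (X t) := fun t => Function.iterate_succ_apply' _ _ _
  have hshift : ∀ (k : Fin m) t i, X t (c k) = false →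
      X (t + i) (c ⟨(k + i) % m, Nat.mod_lt _ hm⟩) = false := by
    intro k t i h
    induction i with
    | zero => simpa [Nat.mod_eq_of_lt k.2] using h
    | succ i ih =>
      rw [← Nat.add_assoc, hX]
      have ha := hcyc ⟨(k + i) % m, Nat.mod_lt _ hm⟩
      simp only [Nat.mod_add_mod, Nat.add_assoc] at ha
      exact R.network_eq_false_of_parent (R.not_onPath_of_mem (hmemC _)) ha
        (fun h => absurd h.symm (hvc _)) ih
  obtain ⟨t, ht, hoff⟩ := R.exists_forall_mem_eq_false hX
    (fun y hy => by obtain ⟨k, rfl⟩ := hCex y hy; exact hvadj k) (by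
      intro y hy t h y' hy'
      obtain ⟨k, rfl⟩ := hCex y hy
      obtain ⟨k', rfl⟩ := hCex y' hy'
      rw [hcard] at h ⊢
      obtain ⟨i, hi, hki⟩ : ∃ i < m, (k + i) % m = (k' : ℕ) := by
        refine ⟨(k' + (m - k)) % m, Nat.mod_lt _ hm, ?_⟩
        have he : (k : ℕ) + (k' + (m - k)) = k' + m := by omega
        rw [Nat.add_mod_mod, he, Nat.add_mod_right, Nat.mod_eq_of_lt k'.2]
      have := hshift k (t + (m - 1 - i)) i (h _ (by omega))
      rw [show t + (m - 1 - i) + i = t + (m - 1) by omega] at this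
      simpa only [hki] using this)
  rw [Fintype.card_fin] at ht
  have hmn : m ≤ n := by simpa [hcard] using C.card_le_univ
  funext i
  have := R.eq_false_of_forall_mem_eq_false hX hvC hpred hoff (2 * n - m + 1 - t)
    (by rw [Fintype.card_fin, hcard]; omega) i
  rwa [show t + (2 * n - m + 1 - t) = 2 * n - m + 1 by omega] at this
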